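/- arXiv:2007.06861 — 11 statements merged into one kernel-verified Lean document; each statement's English description precedes it below -/
import Mathlib

section
/- Let n ≥ 1, let e ∈ ℝⁿ satisfy e(i) − e(j) ∉ ℤ for all 1 ≤ i < j ≤ n, and let v ∈ ℝⁿ satisfy v + e ∈ ℤⁿ. If h(v) ≥ 1, then δ(ς(v)) = δ(v) − 1 and h(ς(v)) = h(v) − 1. -/
/-- `vmin v` is `min[v]`, the minimum of the coordinates of `v`. -/
noncomputable def vmin {n : ℕ} (v : Fin n → ℝ) : ℝ := ⨅ i, v i

/-- `vmax v` is `max[v]`, the maximum of the coordinates of `v`. -/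
noncomputable def vmax {n : ℕ} (v : Fin n → ℝ) : ℝ := ⨆ i, v i

/-- `vdelta v = ⟨v⟩ - n · min[v]`. -/
noncomputable def vdelta {n : ℕ} (v : Fin n → ℝ) : ℝ := (∑ i, v i) - n * vmin v

/-- `vh v = Σ_i ⌊v(i) - min[v]⌋`. -/
noncomputable def vh {n : ℕ} (v : Fin n → ℝ) : ℤ := ∑ i, ⌊v i - vmin v⌋

/-- `vsig v = ς(v)`, subtracting 1 from every maximal coordinate of `v`. -/
noncomputable def vsig {n : ℕ} (v : Fin n → ℝ) : Fin n → ℝ :=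
  fun i => if v i = vmax v then v i - 1 else v i

theorem vmin_eq_of_forall_le {n : ℕ} {v : Fin n → ℝ} {k : Fin n} (h : ∀ i, v k ≤ v i) :
    vmin v = v k :=
  have : Nonempty (Fin n) := ⟨k⟩
  le_antisymm (ciInf_le (Set.finite_range v).bddBelow k) (le_ciInf h)

theorem vmax_eq_of_forall_le {n : ℕ} {v : Fin n → ℝ} {m : Fin n} (h : ∀ i, v i ≤ v m) :
    vmax v = v m :=
  have : Nonempty (Fin n) := ⟨m⟩
  le_antisymm (ciSup_le h) (le_ciSup (Set.finite_range v).bddAbove m)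

theorem injective_of_add_mem_int {n : ℕ} {e v : Fin n → ℝ}
    (he : ∀ i j : Fin n, i < j → ¬ ∃ z : ℤ, e i - e j = (z : ℝ))
    (hv : ∀ i, ∃ z : ℤ, v i + e i = (z : ℝ)) : Function.Injective v := by
  refine Function.Injective.of_lt_imp_ne fun i j hij h => he i j hij ?_
  obtain ⟨a, ha⟩ := hv i
  obtain ⟨b, hb⟩ := hv j
  exact ⟨a - b, by push_cast; linarith⟩

/-- If some floor in `vh v` is positive, the maximum exceeds the minimum by at least one. -/
theorem vmin_add_one_le_of_one_le_vh {n : ℕ} {v : Fin n → ℝ} {m : Fin n}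
    (hm : ∀ i, v i ≤ v m) (hh : 1 ≤ vh v) : vmin v + 1 ≤ v m := by
  obtain ⟨i, -, hi⟩ := Finset.exists_lt_of_sum_lt
    (show ∑ _i : Fin n, (0 : ℤ) < ∑ i, ⌊v i - vmin v⌋ by simpa [vh] using zero_lt_one.trans_le hh)
  have : (1 : ℝ) ≤ v i - vmin v := by simpa using Int.le_floor.mp (Int.add_one_le_of_lt hi)
  linarith [hm i]

theorem vsig_apply_of_injective {n : ℕ} {v : Fin n → ℝ} {m : Fin n}
    (hinj : Function.Injective v) (hm : ∀ i, v i ≤ v m) (i : Fin n) :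
    vsig v i = v i - if i = m then 1 else 0 := by
  simp only [vsig, vmax_eq_of_forall_le hm, hinj.eq_iff]
  split_ifs <;> simp

/-- Lowering the unique maximum by one does not change the minimum. -/
theorem vmin_vsig {n : ℕ} {v : Fin n → ℝ} {m : Fin n}
    (hinj : Function.Injective v) (hm : ∀ i, v i ≤ v m) (hgap : vmin v + 1 ≤ v m) :
    vmin (vsig v) = vmin v := by
  have : Nonempty (Fin n) := ⟨m⟩
  obtain ⟨k, hk⟩ := Finite.exists_min v
  have hmin := vmin_eq_of_forall_le hk
  have hkm : k ≠ m := by rintro rfl; linarith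
  have hsk : vsig v k = v k := by simp [vsig_apply_of_injective hinj hm, hkm]
  rw [hmin, ← hsk]
  refine vmin_eq_of_forall_le fun i => ?_
  rw [hsk, vsig_apply_of_injective hinj hm]
  split_ifs with h
  · subst h; linarith
  · simpa using hk i

theorem stmt_0 {n : ℕ} (hn : 1 ≤ n) (e v : Fin n → ℝ)
    (he : ∀ i j : Fin n, i < j → ¬ ∃ z : ℤ, e i - e j = (z : ℝ))
    (hv : ∀ i, ∃ z : ℤ, v i + e i = (z : ℝ))
    (hh : 1 ≤ vh v) :
    vdelta (vsig v) = vdelta v - 1 ∧ vh (vsig v) = vh v - 1 := by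
  have : Nonempty (Fin n) := ⟨⟨0, hn⟩⟩
  have hinj := injective_of_add_mem_int he hv
  obtain ⟨m, hm⟩ := Finite.exists_max v
  have hmin := vmin_vsig hinj hm (vmin_add_one_le_of_one_le_vh hm hh)
  have hsig := vsig_apply_of_injective hinj hm
  constructor
  · simp only [vdelta, hmin, hsig, Finset.sum_sub_distrib, Finset.sum_ite_eq',
      Finset.mem_univ, if_true]
    ring
  · have hfloor (i : Fin n) :
        ⌊vsig v i - vmin v⌋ = ⌊v i - vmin v⌋ - if i = m then 1 else 0 := by
      rw [hsig, sub_right_comm]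
      split_ifs <;> simp
    simp [vh, hmin, hfloor, Finset.sum_sub_distrib]
end

section
/- Let n ≥ 1, let e ∈ ℝⁿ satisfy e(i) − e(j) ∉ ℤ for all 1 ≤ i < j ≤ n, and let v ∈ ℝⁿ satisfy v + e ∈ ℤⁿ. If h(v) = 0, then h(ς(v)) = 0. -/
/-- For a nonempty index set, `h(v) = 0` exactly when any two coordinates of `v` differ by less
than `1`. -/
theorem vh_eq_zero_iff {n : ℕ} (hn : 1 ≤ n) (v : Fin n → ℝ) :
    vh v = 0 ↔ ∀ i j, v i < v j + 1 := by
  have : Nonempty (Fin n) := ⟨⟨0, hn⟩⟩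
  have hmin : ∀ i, vmin v ≤ v i := ciInf_le (Set.finite_range v).bddBelow
  obtain ⟨k, hk⟩ : ∃ k, v k = vmin v := exists_eq_ciInf_of_finite
  have hfloor : ∀ i, 0 ≤ ⌊v i - vmin v⌋ := fun i => Int.floor_nonneg.2 (sub_nonneg.2 (hmin i))
  rw [vh, Finset.sum_eq_zero_iff_of_nonneg fun i _ => hfloor i]
  simp only [Finset.mem_univ, true_imp_iff, Int.floor_eq_zero_iff, Set.mem_Ico]
  refine ⟨fun h i j => ?_, fun h i => ⟨sub_nonneg.2 (hmin i), ?_⟩⟩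
  · linarith [(h i).2, hmin j]
  · linarith [h i k]

theorem stmt_1 {n : ℕ} (hn : 1 ≤ n) (e v : Fin n → ℝ)
    (he : ∀ i j : Fin n, i < j → ¬ ∃ z : ℤ, e i - e j = (z : ℝ))
    (hv : ∀ i, ∃ z : ℤ, v i + e i = (z : ℝ))
    (hh : vh v = 0) :
    vh (vsig v) = 0 := by
  rw [vh_eq_zero_iff hn] at hh ⊢
  have hmax : ∀ i, v i ≤ vmax v := le_ciSup (Set.finite_range v).bddAbove
  intro i j
  have hij := hh i j
  simp only [vsig]
  split_ifs with hi hj hj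
  · linarith
  · linarith
  · linarith [lt_of_le_of_ne (hmax i) hi]
  · exact hij
end

section
/- Let n ≥ 1, let e ∈ ℝⁿ satisfy e(i) − e(j) ∉ ℤ for all 1 ≤ i < j ≤ n, and let v, v' ∈ ℝⁿ satisfy v + e ∈ ℤⁿ, v' + e ∈ ℤⁿ and ⟨v⟩ = ⟨v'⟩. If h(v) = h(v') = 0, then v = v'. -/
theorem vmin_le {n : ℕ} (v : Fin n → ℝ) (i : Fin n) : vmin v ≤ v i :=
  ciInf_le (Set.finite_range v).bddBelow i

theorem lt_vmin_add_one_of_vh_eq_zero {n : ℕ} {v : Fin n → ℝ} (h : vh v = 0) (i : Fin n) :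
    v i < vmin v + 1 := by
  have hfloor : ⌊v i - vmin v⌋ = 0 :=
    (Finset.sum_eq_zero_iff_of_nonneg
      fun j _ => Int.floor_nonneg.2 (sub_nonneg.2 (vmin_le v j))).1 h i (Finset.mem_univ i)
  have := (Int.floor_eq_zero_iff.1 hfloor).2
  linarith

/-- Among vectors with `vh v = 0` in a fixed coset of `ℤⁿ`, the coordinatewise order is
determined by the minimal coordinate. -/
theorem le_of_vmin_le_of_vh_eq_zero {n : ℕ} {e v v' : Fin n → ℝ}
    (hv : ∀ i, ∃ z : ℤ, v i + e i = (z : ℝ)) (hv' : ∀ i, ∃ z : ℤ, v' i + e i = (z : ℝ))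
    (hh : vh v = 0) (hmin : vmin v ≤ vmin v') : v ≤ v' := by
  intro i
  obtain ⟨a, ha⟩ := hv i
  obtain ⟨b, hb⟩ := hv' i
  have hlt := lt_vmin_add_one_of_vh_eq_zero hh i
  have hle := vmin_le v' i
  have hab : (a : ℝ) < b + 1 := by linarith
  have hab' : a ≤ b := Int.lt_add_one_iff.1 (by exact_mod_cast hab)
  have : (a : ℝ) ≤ b := by exact_mod_cast hab'
  linarith

theorem eq_of_le_of_sum_eq {n : ℕ} {v v' : Fin n → ℝ} (hle : v ≤ v')
    (hsum : ∑ i, v i = ∑ i, v' i) : v = v' :=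
  funext fun i => (Finset.sum_eq_sum_iff_of_le fun j _ => hle j).1 hsum i (Finset.mem_univ i)

theorem stmt_2 {n : ℕ} (hn : 1 ≤ n) (e v v' : Fin n → ℝ)
    (he : ∀ i j : Fin n, i < j → ¬ ∃ z : ℤ, e i - e j = (z : ℝ))
    (hv : ∀ i, ∃ z : ℤ, v i + e i = (z : ℝ))
    (hv' : ∀ i, ∃ z : ℤ, v' i + e i = (z : ℝ))
    (hsum : ∑ i, v i = ∑ i, v' i)
    (hh : vh v = 0) (hh' : vh v' = 0) :
    v = v' := by
  rcases le_total (vmin v) (vmin v') with hmin | hmin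
  · exact eq_of_le_of_sum_eq (le_of_vmin_le_of_vh_eq_zero hv hv' hh hmin) hsum
  · exact (eq_of_le_of_sum_eq (le_of_vmin_le_of_vh_eq_zero hv' hv hh' hmin) hsum.symm).symm
end

section
/- Let n ≥ 1, let e ∈ ℝⁿ satisfy e(i) − e(j) ∉ ℤ for all 1 ≤ i < j ≤ n, and let v, v' ∈ ℝⁿ satisfy v + e ∈ ℤⁿ, v' + e ∈ ℤⁿ and ⟨v⟩ = ⟨v'⟩. Then δ(v) ≤ δ(v') if and only if h(v) ≤ h(v'). -/
theorem vdelta_le_vdelta_iff {n : ℕ} (hn : 1 ≤ n) {v v' : Fin n → ℝ}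
    (hsum : ∑ i, v i = ∑ i, v' i) : vdelta v ≤ vdelta v' ↔ vmin v' ≤ vmin v := by
  have hn' : (0 : ℝ) < n := by exact_mod_cast hn
  rw [vdelta, vdelta, hsum, sub_le_sub_iff_left, mul_le_mul_iff_right₀ hn']

theorem sum_floor_sub_eq_of_sub_mem_int {n : ℕ} {v v' : Fin n → ℝ}
    (hint : ∀ i, ∃ z : ℤ, v' i - v i = (z : ℝ)) (hsum : ∑ i, v i = ∑ i, v' i) (m : ℝ) :
    ∑ i, ⌊v' i - m⌋ = ∑ i, ⌊v i - m⌋ := by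
  choose k hk using hint
  have hk_sum : ∑ i, k i = 0 := by
    have : ∑ i, (k i : ℝ) = 0 := by
      simp_rw [← hk]
      rw [Finset.sum_sub_distrib, hsum, sub_self]
    exact_mod_cast this
  have hfloor : ∀ i, ⌊v' i - m⌋ = ⌊v i - m⌋ + k i := fun i => by
    rw [← Int.floor_add_intCast, ← hk]
    congr 1
    ring
  simp_rw [hfloor]
  rw [Finset.sum_add_distrib, hk_sum, add_zero]

theorem sum_floor_sub_antitone {n : ℕ} (v : Fin n → ℝ) :
    Antitone fun m : ℝ => ∑ i, ⌊v i - m⌋ := fun _ _ hm =>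
  Finset.sum_le_sum fun i _ => Int.floor_le_floor (sub_le_sub_left hm (v i))

theorem sum_floor_sub_lt_vh {n : ℕ} (hn : 1 ≤ n) (v : Fin n → ℝ) {m : ℝ} (hm : vmin v < m) :
    ∑ i, ⌊v i - m⌋ < vh v := by
  have : Nonempty (Fin n) := ⟨⟨0, hn⟩⟩
  obtain ⟨j, hj⟩ : ∃ j, v j = vmin v := exists_eq_ciInf_of_finite
  refine Finset.sum_lt_sum
    (fun i _ => Int.floor_le_floor (sub_le_sub_left hm.le (v i))) ⟨j, Finset.mem_univ j, ?_⟩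
  rw [hj, sub_self, Int.floor_zero, Int.floor_lt]
  simpa using hm

theorem stmt_3 {n : ℕ} (hn : 1 ≤ n) (e v v' : Fin n → ℝ)
    (he : ∀ i j : Fin n, i < j → ¬ ∃ z : ℤ, e i - e j = (z : ℝ))
    (hv : ∀ i, ∃ z : ℤ, v i + e i = (z : ℝ))
    (hv' : ∀ i, ∃ z : ℤ, v' i + e i = (z : ℝ))
    (hsum : ∑ i, v i = ∑ i, v' i) :
    vdelta v ≤ vdelta v' ↔ vh v ≤ vh v' := by
  have hint : ∀ i, ∃ z : ℤ, v' i - v i = (z : ℝ) := fun i => by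
    obtain ⟨a, ha⟩ := hv i
    obtain ⟨b, hb⟩ := hv' i
    exact ⟨b - a, by push_cast; linarith⟩
  have hvh' : vh v' = ∑ i, ⌊v i - vmin v'⌋ := sum_floor_sub_eq_of_sub_mem_int hint hsum _
  rw [vdelta_le_vdelta_iff hn hsum, hvh']
  refine ⟨fun h => sum_floor_sub_antitone v h, fun h => ?_⟩
  by_contra! hlt
  exact (sum_floor_sub_lt_vh hn v hlt).not_ge h
end

section
/- Let p ≥ 2 and n ≥ 2 be integers and let m be an integer such that for every divisor d of n with 1 ≤ d < n, pⁿ − 1 does not divide m(p^d − 1). Define e' ∈ ℚⁿ by e'(i) = −m·p^{i−1}/(pⁿ − 1) for 1 ≤ i ≤ n. Then e'(i) ∉ ℤ for every i, and e'(i) − e'(j) ∉ ℤ for all i ≠ j. -/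
theorem isCoprime_pow_sub_one_pow (p : ℤ) {n : ℕ} (hn : n ≠ 0) (i : ℕ) :
    IsCoprime (p ^ n - 1) (p ^ i) := by
  refine IsCoprime.pow_right ⟨-1, p ^ (n - 1), ?_⟩
  rw [pow_sub_one_mul hn]
  ring

theorem dvd_mul_pow_gcd_sub_one {p : ℕ} (hp : 1 ≤ p) {k n : ℕ} {N m : ℤ}
    (hk : N ∣ m * ((p : ℤ) ^ k - 1)) (hn : N ∣ m * ((p : ℤ) ^ n - 1)) :
    N ∣ m * ((p : ℤ) ^ k.gcd n - 1) := by
  have cast_sub (a : ℕ) : ((p ^ a - 1 : ℕ) : ℤ) = (p : ℤ) ^ a - 1 := by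
    rw [Nat.cast_sub (Nat.one_le_pow _ _ hp)]
    push_cast
    rfl
  have bezout := Nat.gcd_eq_gcd_ab (p ^ k - 1) (p ^ n - 1)
  rw [Nat.pow_sub_one_gcd_pow_sub_one, cast_sub, cast_sub, cast_sub] at bezout
  rw [bezout, mul_add, ← mul_assoc, ← mul_assoc]
  exact dvd_add (hk.mul_right _) (hn.mul_right _)

theorem not_dvd_mul_pow_sub_pow {p n : ℕ} (hp : 1 ≤ p) {m : ℤ}
    (H : ∀ d : ℕ, d ∣ n → 1 ≤ d → d < n → ¬ ((p : ℤ) ^ n - 1 ∣ m * ((p : ℤ) ^ d - 1)))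
    {i j : ℕ} (hij : i < j) (hj : j < n) :
    ¬ ((p : ℤ) ^ n - 1 ∣ m * ((p : ℤ) ^ j - (p : ℤ) ^ i)) := by
  intro h
  obtain ⟨k, rfl⟩ := Nat.exists_eq_add_of_lt hij
  have hfactor : m * ((p : ℤ) ^ (i + k + 1) - (p : ℤ) ^ i) =
      (p : ℤ) ^ i * (m * ((p : ℤ) ^ (k + 1) - 1)) := by ring
  rw [hfactor] at h
  have hk := (isCoprime_pow_sub_one_pow (p : ℤ) (by omega) i).dvd_of_dvd_mul_left h
  have hle : (k + 1).gcd n ≤ k + 1 := Nat.gcd_le_left n k.succ_pos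
  exact H _ (Nat.gcd_dvd_right (k + 1) n) (Nat.gcd_pos_of_pos_left n (Nat.succ_pos k))
    (by omega) (dvd_mul_pow_gcd_sub_one hp hk (dvd_mul_left _ _))

theorem stmt_8 (p n : ℕ) (hp : 2 ≤ p) (hn : 2 ≤ n) (m : ℤ)
    (H : ∀ d : ℕ, d ∣ n → 1 ≤ d → d < n → ¬ ((p : ℤ) ^ n - 1 ∣ m * ((p : ℤ) ^ d - 1)))
    (e' : Fin n → ℚ)
    (he' : e' = fun i : Fin n => -(m : ℚ) * (p : ℚ) ^ (i : ℕ) / ((p : ℚ) ^ n - 1)) :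
    (∀ i : Fin n, ¬ ∃ z : ℤ, e' i = (z : ℚ)) ∧
    (∀ i j : Fin n, i ≠ j → ¬ ∃ z : ℤ, e' i - e' j = (z : ℚ)) := by
  have hN : (p : ℚ) ^ n - 1 ≠ 0 :=
    (sub_pos.2 (one_lt_pow₀ (by exact_mod_cast hp) (by omega))).ne'
  subst he'
  refine ⟨?_, ?_⟩
  · rintro i ⟨z, hz⟩
    rw [div_eq_iff hN] at hz
    have hz' : -m * (p : ℤ) ^ (i : ℕ) = z * ((p : ℤ) ^ n - 1) := by exact_mod_cast hz
    have hdvd : (p : ℤ) ^ n - 1 ∣ m * (p : ℤ) ^ (i : ℕ) := ⟨-z, by linear_combination -hz'⟩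
    have hm := (isCoprime_pow_sub_one_pow (p : ℤ) (by omega) (i : ℕ)).dvd_of_dvd_mul_right hdvd
    exact H 1 (one_dvd n) le_rfl (by omega) (hm.mul_right _)
  · rintro i j hij ⟨z, hz⟩
    rw [← sub_div, div_eq_iff hN] at hz
    have hz' : -m * (p : ℤ) ^ (i : ℕ) - -m * (p : ℤ) ^ (j : ℕ) = z * ((p : ℤ) ^ n - 1) := by
      exact_mod_cast hz
    rcases lt_or_gt_of_ne hij with h | h
    · exact not_dvd_mul_pow_sub_pow (by omega) H h j.isLt ⟨z, by linear_combination hz'⟩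
    · exact not_dvd_mul_pow_sub_pow (by omega) H h i.isLt ⟨-z, by linear_combination -hz'⟩
end

section
/- Let n ≥ 1, let ε ≥ 1 be an integer, let w be a permutation of {1, …, n} acting on ℝⁿ by (w·v)(i) = v(w⁻¹(i)), and let m ∈ {0, 1}. Let e ∈ ℝⁿ satisfy e(1) > e(2) > ⋯ > e(n) > e(1) − 1. Let v, v' ∈ ℝⁿ be such that: v + e ∈ ℤⁿ; the coordinates of v' are pairwise distinct; and the vector ν := −v + ε·(w·v') is a coordinate permutation of (m, 0, …, 0). Assume there is no pair (i, j) with i ≠ j such that (v + e)_{(i,j)} ≥ 1 and ν(i) − ν(j) = −1. Then v = ε·(w·v') if m = 0, and v = ς(ε·(w·v')) if m = 1. -/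
theorem stmt_10 {n : ℕ} (hn : 1 ≤ n) (ε : ℕ) (hε : 1 ≤ ε)
    (w : Equiv.Perm (Fin n)) (m : ℕ) (hm : m = 0 ∨ m = 1)
    (e v v' : Fin n → ℝ)
    -- e(1) > e(2) > ⋯ > e(n) > e(1) - 1
    (he1 : StrictAnti e)
    (he2 : e ⟨0, by omega⟩ - 1 < e ⟨n - 1, by omega⟩)
    -- v + e ∈ ℤⁿ
    (hv : ∀ i, ∃ z : ℤ, v i + e i = (z : ℝ))
    -- coordinates of v' pairwise distinct
    (hv' : Function.Injective v')
    -- ν = -v + ε·(w·v') is a coordinate permutation of (m, 0, …, 0)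
    (hν : ∃ i₀ : Fin n, -v i₀ + ε * v' (w⁻¹ i₀) = (m : ℝ) ∧
      ∀ i, i ≠ i₀ → -v i + ε * v' (w⁻¹ i) = 0)
    -- no pair (i, j), i ≠ j, with (v + e)_{(i,j)} ≥ 1 and ν(i) - ν(j) = -1
    (hR : ¬ ∃ i j : Fin n, i ≠ j ∧
      (1 : ℝ) ≤ (if i < j then (v i + e i) - (v j + e j) - 1 else (v i + e i) - (v j + e j)) ∧
      (-v i + ε * v' (w⁻¹ i)) - (-v j + ε * v' (w⁻¹ j)) = -1) :
    (m = 0 → v = fun i => ε * v' (w⁻¹ i)) ∧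
    (m = 1 → v = vsig (fun i => ε * v' (w⁻¹ i))) := by
  obtain ⟨i₀, h₀, hne⟩ := hν
  refine ⟨fun hm0 => funext fun i => ?_, fun hm1 => ?_⟩
  · rcases eq_or_ne i i₀ with rfl | hi
    · rw [hm0, Nat.cast_zero] at h₀
      linarith
    · linarith [hne i hi]
  · rw [hm1, Nat.cast_one] at h₀
    have he_lt : ∀ i j, e i - e j < 1 := fun i j => by
      have hi : e i ≤ e ⟨0, by omega⟩ := he1.antitone (Fin.le_def.2 (Nat.zero_le _))
      have hj : e ⟨n - 1, by omega⟩ ≤ e j :=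
        he1.antitone (Fin.le_def.2 (Nat.le_sub_one_of_lt j.isLt))
      linarith
    have hlt : ∀ i, i ≠ i₀ → (ε : ℝ) * v' (w⁻¹ i) < ε * v' (w⁻¹ i₀) := by
      intro i hi
      by_contra! hle
      refine hR ⟨i, i₀, hi, ?_, by rw [h₀, hne i hi]; norm_num⟩
      have hν_i := hne i hi
      obtain ⟨a, ha⟩ := hv i
      obtain ⟨b, hb⟩ := hv i₀
      rw [ha, hb]
      split_ifs with hlt
      · have he := he1 hlt
        have hab : b + 1 < a := by
          have : (b : ℝ) + 1 < a := by linarith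
          exact_mod_cast this
        have : (b : ℝ) + 1 + 1 ≤ a := by exact_mod_cast hab
        linarith
      · have he := he_lt i₀ i
        have hab : b < a := by
          have : (b : ℝ) < a := by linarith
          exact_mod_cast this
        have : (b : ℝ) + 1 ≤ a := by exact_mod_cast hab
        linarith
    have hmax : vmax (fun i => (ε : ℝ) * v' (w⁻¹ i)) = ε * v' (w⁻¹ i₀) := by
      have : Nonempty (Fin n) := ⟨i₀⟩
      refine le_antisymm (ciSup_le fun i => ?_)
        (le_ciSup (f := fun i => (ε : ℝ) * v' (w⁻¹ i)) (Set.finite_range _).bddAbove i₀)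
      rcases eq_or_ne i i₀ with rfl | hi
      · exact le_rfl
      · exact (hlt i hi).le
    funext i
    simp only [vsig, hmax]
    rcases eq_or_ne i i₀ with rfl | hi
    · rw [if_pos rfl]
      linarith
    · rw [if_neg (hlt i hi).ne]
      linarith [hne i hi]
end

section
/- Let n ≥ 1 and N ≥ 1. For each k ∈ ℤ/N let ε^k ≥ 1 be an integer, w^k a permutation of {1, …, n} acting on ℝⁿ by (w^k·v)(i) = v((w^k)⁻¹(i)), m^k ∈ {0, 1}, and v^k ∈ ℝⁿ, such that v^k = ς^{m^k}(ε^k·(w^k·v^{k+1})) for all k (indices taken mod N, ς⁰ = id, ς¹ = ς). Suppose that ∏_k ε^k ≥ 2 and that 0 ∉ [v^k] for every k. Then there exists k with h(v^k) = 0. -/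
theorem le_vmax {n : ℕ} (v : Fin n → ℝ) (i : Fin n) : v i ≤ vmax v :=
  le_ciSup (Set.finite_range v).bddAbove i

theorem exists_eq_vmin {n : ℕ} [NeZero n] (v : Fin n → ℝ) : ∃ i, v i = vmin v :=
  exists_eq_ciInf_of_finite

theorem vmin_eq_of_le {n : ℕ} [NeZero n] {v : Fin n → ℝ} {a : ℝ} (i : Fin n) (hi : v i = a)
    (h : ∀ j, a ≤ v j) : vmin v = a :=
  le_antisymm (hi ▸ vmin_le v i) (le_ciInf h)

theorem vmin_mul_comp_perm {n : ℕ} [NeZero n] {c : ℝ} (hc : 0 ≤ c) (σ : Equiv.Perm (Fin n))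
    (v : Fin n → ℝ) : vmin (fun i => c * v (σ i)) = c * vmin v := by
  obtain ⟨i, hi⟩ := exists_eq_vmin v
  exact vmin_eq_of_le (σ.symm i) (by simp [hi])
    fun j => mul_le_mul_of_nonneg_left (vmin_le v _) hc

/-- If the coordinates of `v` spread over a length at least `1`, then `ς` preserves `min[v]`. -/
theorem vmin_vsig_s11 {n : ℕ} [NeZero n] {v : Fin n → ℝ} {j : Fin n} (hj : vmin v + 1 ≤ v j) :
    vmin (vsig v) = vmin v := by
  have hmax : vmin v + 1 ≤ vmax v := hj.trans (le_vmax v j)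
  obtain ⟨i, hi⟩ := exists_eq_vmin v
  refine vmin_eq_of_le i ?_ fun l => ?_
  · rw [vsig, if_neg (by linarith), hi]
  · have := vmin_le v l
    unfold vsig
    split_ifs <;> linarith

/-- If `h(v) ≠ 0`, the coordinates of `v` spread over a length at least `1`. -/
theorem exists_vmin_add_one_le_of_vh_ne_zero {n : ℕ} {v : Fin n → ℝ} (h : vh v ≠ 0) :
    ∃ i, vmin v + 1 ≤ v i := by
  contrapose! h
  refine Finset.sum_eq_zero fun i _ => Int.floor_eq_zero_iff.2 ⟨?_, ?_⟩
  · linarith [vmin_le v i]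
  · linarith [h i]

theorem stmt_11 {n : ℕ} (hn : 1 ≤ n) (N : ℕ) [NeZero N]
    (ε : ZMod N → ℕ) (hε : ∀ k, 1 ≤ ε k)
    (w : ZMod N → Equiv.Perm (Fin n))
    (m : ZMod N → ℕ) (hm : ∀ k, m k = 0 ∨ m k = 1)
    (v : ZMod N → Fin n → ℝ)
    (hrec : ∀ k, v k = vsig^[m k] (fun i => ε k * v (k + 1) ((w k)⁻¹ i)))
    (hprod : 2 ≤ ∏ k, ε k)
    (hnz : ∀ k i, v k i ≠ 0) :
    ∃ k, vh (v k) = 0 := by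
  by_contra! hvh
  have : NeZero n := ⟨by omega⟩
  have hmin : ∀ k, vmin (v k) = ε k * vmin (v (k + 1)) := by
    intro k
    have hε1 : (1 : ℝ) ≤ ε k := by exact_mod_cast hε k
    have hu := vmin_mul_comp_perm (by linarith : (0 : ℝ) ≤ ε k) (w k)⁻¹ (v (k + 1))
    rw [hrec k]
    rcases hm k with h | h
    · rw [h, Function.iterate_zero_apply, hu]
    · obtain ⟨j, hj⟩ := exists_vmin_add_one_le_of_vh_ne_zero (hvh (k + 1))
      rw [h, Function.iterate_one, vmin_vsig_s11 (j := w k j), hu]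
      rw [hu, Equiv.Perm.inv_def, Equiv.symm_apply_apply]
      nlinarith
  have hne : ∏ k, vmin (v k) ≠ 0 := by
    refine Finset.prod_ne_zero_iff.2 fun k _ => ?_
    obtain ⟨i, hi⟩ := exists_eq_vmin (v k)
    exact hi ▸ hnz k i
  have hcycle : ∏ k, vmin (v k) = (∏ k, (ε k : ℝ)) * ∏ k, vmin (v k) := by
    conv_lhs => rw [Finset.prod_congr rfl fun k _ => hmin k, Finset.prod_mul_distrib]
    congr 1
    exact Equiv.prod_comp (Equiv.addRight (1 : ZMod N)) fun k => vmin (v k)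
  have hone : ∏ k, ε k = 1 := by
    exact_mod_cast (mul_eq_right₀ hne).1 hcycle.symm
  omega
end

section
/- Let n ≥ 1 and N ≥ 1. For each k ∈ ℤ/N let ε^k ≥ 1 be an integer with ∏_k ε^k ≥ 2, let w^k be a permutation of {1, …, n} acting on ℝⁿ by (w^k·v)(i) = v((w^k)⁻¹(i)), let m^k ∈ {0, 1}, and let e^k ∈ ℝⁿ satisfy e^k(i) ∉ ℤ for all i and e^k(i) − e^k(j) ∉ ℤ for all i ≠ j. Suppose (v^k)_{k∈ℤ/N} and (v'^k)_{k∈ℤ/N} are two families of vectors in ℝⁿ such that for every k: v^k + e^k ∈ ℤⁿ, v'^k + e^k ∈ ℤⁿ, ⟨v^k⟩ = ⟨v'^k⟩, v^k = ς^{m^k}(ε^k·(w^k·v^{k+1})), and v'^k = ς^{m^k}(ε^k·(w^k·v'^{k+1})) (indices mod N, ς⁰ = id, ς¹ = ς). Then v^k = v'^k for every k. -/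
/-- Any two coordinates of `v` differ by less than `1`. -/
def SpreadLtOne {n : ℕ} (v : Fin n → ℝ) : Prop := ∀ i j, v i < v j + 1

/-- Every coordinate of `v` is bounded below by some coordinate of `v'`;
for `n ≥ 1` this says `min[v'] ≤ min[v]`. -/
def MinGE {n : ℕ} (v v' : Fin n → ℝ) : Prop := ∀ i, ∃ j, v' j ≤ v i

section

variable {n : ℕ} {u v v' : Fin n → ℝ}

theorem MinGE.trans (h : MinGE u v) (h' : MinGE v v') : MinGE u v' := fun i =>
  let ⟨j, hj⟩ := h i
  let ⟨l, hl⟩ := h' j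
  ⟨l, hl.trans hj⟩

theorem MinGE.of_le (h : v' ≤ v) : MinGE v v' := fun i => ⟨i, h i⟩

theorem MinGE.scale_perm (h : MinGE v v') (a : ℕ) (w : Equiv.Perm (Fin n)) :
    MinGE (fun i => a * v (w⁻¹ i)) (fun i => a * v' (w⁻¹ i)) := fun i => by
  obtain ⟨j, hj⟩ := h (w⁻¹ i)
  refine ⟨w j, ?_⟩
  simpa using mul_le_mul_of_nonneg_left hj (Nat.cast_nonneg a)

theorem vsig_le (v : Fin n → ℝ) : vsig v ≤ v := fun i => by
  unfold vsig
  split_ifs <;> linarith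

/-- A vector of spread less than `1` is determined by its sum and its residues modulo `ℤ`,
among all vectors whose minimum is at least as large. -/
theorem SpreadLtOne.eq_of_minGE (hb : SpreadLtOne v) (hint : ∀ i, ∃ z : ℤ, v' i - v i = z)
    (hsum : ∑ i, v i = ∑ i, v' i) (h : MinGE v' v) : v = v' := by
  have hle : ∀ i, v i ≤ v' i := fun i => by
    obtain ⟨z, hz⟩ := hint i
    obtain ⟨j, hj⟩ := h i
    have hz' : (-1 : ℝ) < z := by linarith [hb i j]
    have hz0 : (0 : ℤ) ≤ z := by
      have : (-1 : ℤ) < z := by exact_mod_cast hz'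
      omega
    have : (0 : ℝ) ≤ z := by exact_mod_cast hz0
    linarith
  funext i
  exact (Finset.sum_eq_sum_iff_of_le fun i _ => hle i).1 hsum i (Finset.mem_univ i)

/-- A vector of spread less than `1` has the largest minimum for its sum and
its residues modulo `ℤ`. -/
theorem SpreadLtOne.minGE (hb : SpreadLtOne v) (hint : ∀ i, ∃ z : ℤ, v' i - v i = z)
    (hsum : ∑ i, v i = ∑ i, v' i) : MinGE v v' := by
  by_contra hcon
  unfold MinGE at hcon
  push Not at hcon
  obtain ⟨i, hi⟩ := hcon
  have heq := hb.eq_of_minGE hint hsum fun j => ⟨i, (hi j).le⟩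
  exact (hi i).ne (congrFun heq i)

/-- Unless `ς(u)` has spread less than `1`, applying `ς` to `u` does not lower the minimum. -/
theorem vsig_minGE_of_not_spreadLtOne (hb : ¬ SpreadLtOne (vsig u)) : MinGE (vsig u) u := by
  have hmax : ∀ j, u j ≤ vmax u := fun j => le_ciSup (Set.finite_range u).bddAbove j
  by_cases hlow : ∃ j, u j ≤ vmax u - 1
  · obtain ⟨j, hj⟩ := hlow
    intro i
    by_cases hi : u i = vmax u
    · exact ⟨j, by simpa [vsig, hi] using hj⟩
    · exact ⟨i, by simp [vsig, hi]⟩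
  · push Not at hlow
    refine absurd (fun i j => ?_) hb
    have hi : vsig u i < vmax u := by
      unfold vsig
      split_ifs with h
      · linarith
      · exact lt_of_le_of_ne (hmax i) h
    have hj : vmax u - 1 ≤ vsig u j := by
      unfold vsig
      split_ifs with h
      · linarith
      · exact (hlow j).le
    linarith

theorem vsig_iterate_le {m : ℕ} (hm : m = 0 ∨ m = 1) (u : Fin n → ℝ) : vsig^[m] u ≤ u := by
  rcases hm with rfl | rfl
  · exact le_rfl
  · exact vsig_le u

theorem vsig_iterate_minGE_of_not_spreadLtOne {m : ℕ} (hm : m = 0 ∨ m = 1)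
    (hb : ¬ SpreadLtOne (vsig^[m] u)) : MinGE (vsig^[m] u) u := by
  rcases hm with rfl | rfl
  · exact MinGE.of_le le_rfl
  · exact vsig_minGE_of_not_spreadLtOne hb

end

theorem ZMod.forall_of_pred {N : ℕ} [NeZero N] {P : ZMod N → Prop} {k₀ : ZMod N} (h₀ : P k₀)
    (hstep : ∀ k, P (k + 1) → P k) (k : ZMod N) : P k := by
  have key : ∀ t : ℕ, P (k₀ - t) := fun t => by
    induction t with
    | zero => simpa using h₀
    | succ t ih =>
      apply hstep
      convert ih using 1
      push_cast
      ring
  simpa using key (k₀ - k).val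

section

variable {n N : ℕ} [NeZero N] {ε : ZMod N → ℕ} {w : ZMod N → Equiv.Perm (Fin n)}
  {m : ZMod N → ℕ} {v v' : ZMod N → Fin n → ℝ}

/-- If no `v^k` has spread less than `1`, then `min[v^k] = ε^k min[v^{k+1}]` for all `k`, so some
minimum vanishes. -/
theorem exists_spreadLtOne (hn : 1 ≤ n) (hprod : 2 ≤ ∏ k, ε k) (hm : ∀ k, m k = 0 ∨ m k = 1)
    (hne : ∀ k i, v k i ≠ 0)
    (hrec : ∀ k, v k = vsig^[m k] (fun i => ε k * v (k + 1) ((w k)⁻¹ i))) :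
    ∃ k, SpreadLtOne (v k) := by
  by_contra! hcon
  have : Nonempty (Fin n) := ⟨⟨0, hn⟩⟩
  choose p hp using fun k => Finite.exists_min (v k)
  have hmin : ∀ k, v k (p k) = ε k * v (k + 1) (p (k + 1)) := fun k => by
    apply le_antisymm
    · have hle := vsig_iterate_le (hm k) (fun i => ε k * v (k + 1) ((w k)⁻¹ i))
      rw [← hrec k] at hle
      refine (hp k (w k (p (k + 1)))).trans ((hle _).trans_eq ?_)
      simp
    · have hnb := hcon k
      rw [hrec k] at hnb
      have hge := vsig_iterate_minGE_of_not_spreadLtOne (hm k) hnb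
      rw [← hrec k] at hge
      obtain ⟨j, hj⟩ := hge (p k)
      exact (mul_le_mul_of_nonneg_left (hp (k + 1) _) (Nat.cast_nonneg _)).trans hj
  have hshift : ∏ k, v (k + 1) (p (k + 1)) = ∏ k, v k (p k) :=
    Equiv.prod_comp (Equiv.addRight (1 : ZMod N)) fun k => v k (p k)
  have hcycle : ∏ k, v k (p k) = (∏ k, (ε k : ℝ)) * ∏ k, v k (p k) := by
    conv_lhs => rw [Finset.prod_congr rfl fun k _ => hmin k, Finset.prod_mul_distrib, hshift]
  have hpos : ∏ k, v k (p k) ≠ 0 := Finset.prod_ne_zero_iff.2 fun k _ => hne k _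
  have hone : (∏ k, (ε k : ℝ)) = 1 := (right_eq_mul₀ hpos).1 hcycle
  have : ∏ k, ε k = 1 := by exact_mod_cast hone
  omega

/-- The comparison of minima propagates around the cycle. -/
theorem minGE_of_spreadLtOne (hm : ∀ k, m k = 0 ∨ m k = 1)
    (hint : ∀ k i, ∃ z : ℤ, v' k i - v k i = z)
    (hsum : ∀ k, ∑ i, v k i = ∑ i, v' k i)
    (hrec : ∀ k, v k = vsig^[m k] (fun i => ε k * v (k + 1) ((w k)⁻¹ i)))
    (hrec' : ∀ k, v' k = vsig^[m k] (fun i => ε k * v' (k + 1) ((w k)⁻¹ i)))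
    {k₀ : ZMod N} (h₀ : SpreadLtOne (v k₀)) (k : ZMod N) : MinGE (v k) (v' k) := by
  refine ZMod.forall_of_pred (P := fun k => MinGE (v k) (v' k))
    (h₀.minGE (hint k₀) (hsum k₀)) (fun k hk => ?_) k
  by_cases hb : SpreadLtOne (v k)
  · exact hb.minGE (hint k) (hsum k)
  · rw [hrec k] at hb
    rw [hrec k, hrec' k]
    exact ((vsig_iterate_minGE_of_not_spreadLtOne (hm k) hb).trans (hk.scale_perm _ _)).trans
      (MinGE.of_le (vsig_iterate_le (hm k) _))

end

theorem stmt_12 {n : ℕ} (hn : 1 ≤ n) (N : ℕ) [NeZero N]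
    (ε : ZMod N → ℕ) (hε : ∀ k, 1 ≤ ε k) (hprod : 2 ≤ ∏ k, ε k)
    (w : ZMod N → Equiv.Perm (Fin n))
    (m : ZMod N → ℕ) (hm : ∀ k, m k = 0 ∨ m k = 1)
    (e : ZMod N → Fin n → ℝ)
    (he1 : ∀ k i, ¬ ∃ z : ℤ, e k i = (z : ℝ))
    (he2 : ∀ k, ∀ i j : Fin n, i ≠ j → ¬ ∃ z : ℤ, e k i - e k j = (z : ℝ))
    (v v' : ZMod N → Fin n → ℝ)
    (hv : ∀ k i, ∃ z : ℤ, v k i + e k i = (z : ℝ))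
    (hv' : ∀ k i, ∃ z : ℤ, v' k i + e k i = (z : ℝ))
    (hsum : ∀ k, ∑ i, v k i = ∑ i, v' k i)
    (hrec : ∀ k, v k = vsig^[m k] (fun i => ε k * v (k + 1) ((w k)⁻¹ i)))
    (hrec' : ∀ k, v' k = vsig^[m k] (fun i => ε k * v' (k + 1) ((w k)⁻¹ i))) :
    ∀ k, v k = v' k := by
  have hne : ∀ u : ZMod N → Fin n → ℝ, (∀ k i, ∃ z : ℤ, u k i + e k i = (z : ℝ)) →
      ∀ k i, u k i ≠ 0 := fun u hu k i h0 => he1 k i (by simpa [h0] using hu k i)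
  have hint : ∀ k i, ∃ z : ℤ, v' k i - v k i = z := fun k i => by
    obtain ⟨a, ha⟩ := hv k i
    obtain ⟨b, hb⟩ := hv' k i
    exact ⟨b - a, by push_cast; linarith⟩
  have hint' : ∀ k i, ∃ z : ℤ, v k i - v' k i = z := fun k i => by
    obtain ⟨z, hz⟩ := hint k i
    exact ⟨-z, by push_cast; linarith⟩
  obtain ⟨k₀, h₀⟩ := exists_spreadLtOne hn hprod hm (hne v hv) hrec
  obtain ⟨k₁, h₁⟩ := exists_spreadLtOne hn hprod hm (hne v' hv') hrec'
  have hge := minGE_of_spreadLtOne hm hint' (fun k => (hsum k).symm) hrec' hrec h₁ k₀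
  refine ZMod.forall_of_pred (P := fun k => v k = v' k)
    (h₀.eq_of_minGE (hint k₀) (hsum k₀) hge) fun k hk => ?_
  rw [hrec k, hrec' k, hk]
end

section
/- Let p be a prime, let w: ℤ³ → ℤ³ be given by w(a₁, a₂, a₃) = (a₃, a₁, a₂), let τ ∈ ℤ³, and let μ = (μ₁, μ₂, μ₃) ∈ ℤ³ with μ₁ ≥ μ₂ ≥ μ₃. Define λ♮ = −λ + τ + p·w(λ) for λ ∈ ℤ³, and S = {λ ∈ ℤ³ : λ♮ ≤ μ}. Suppose λ, λ' ∈ S satisfy λ' = λ + n₁·α + n₂·w(α) for some coroot α ∈ Δ∨ and integers n₁ > n₂ > 0. Then λ + α ∈ S or λ + α + w(α) ∈ S. -/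
/-- The cyclic rotation `w(a₁, a₂, a₃) = (a₃, a₁, a₂)` on `ℤ³`. -/
def wrot (v : Fin 3 → ℤ) : Fin 3 → ℤ := ![v 2, v 0, v 1]

/-- The set `Δ∨` of coroots of `GL₃`. -/
def coroots : Set (Fin 3 → ℤ) :=
  {![1, -1, 0], ![-1, 1, 0], ![0, 1, -1], ![0, -1, 1], ![-1, 0, 1], ![1, 0, -1]}

/-- Dominance order `v ≤ μ` for `μ = (μ₁ ≥ μ₂ ≥ μ₃)` in `ℤ³`: equal coordinate sums,
`max(v₁,v₂,v₃) ≤ μ₁` and `min(v₁,v₂,v₃) ≥ μ₃`. -/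
def domLE (v μ : Fin 3 → ℤ) : Prop :=
  v 0 + v 1 + v 2 = μ 0 + μ 1 + μ 2 ∧
  max (v 0) (max (v 1) (v 2)) ≤ μ 0 ∧
  μ 2 ≤ min (v 0) (min (v 1) (v 2))

/-- `λ♮ = -λ + τ + p·w(λ)`. -/
def natSharp (p : ℤ) (τ l : Fin 3 → ℤ) : Fin 3 → ℤ :=
  fun i => -l i + τ i + p * wrot l i

/-- The set `S = {λ ∈ ℤ³ : λ♮ ≤ μ}`. -/
def SS (p : ℤ) (τ μ : Fin 3 → ℤ) : Set (Fin 3 → ℤ) :=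
  {l | domLE (natSharp p τ l) μ}

theorem stmt_13 (p : ℕ) (hp : p.Prime) (τ μ : Fin 3 → ℤ)
    (hμ : μ 1 ≤ μ 0 ∧ μ 2 ≤ μ 1)
    (l l' : Fin 3 → ℤ) (hl : l ∈ SS p τ μ) (hl' : l' ∈ SS p τ μ)
    (α : Fin 3 → ℤ) (hα : α ∈ coroots) (n₁ n₂ : ℤ) (h21 : n₂ < n₁) (h2 : 0 < n₂)
    (hrel : l' = fun i => l i + n₁ * α i + n₂ * wrot α i) :
    (fun i => l i + α i) ∈ SS p τ μ ∨ (fun i => l i + α i + wrot α i) ∈ SS p τ μ := by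
  have hp_pos : (0 : ℤ) < p := by exact_mod_cast hp.pos
  have h_gap : (p : ℤ) * n₂ + p ≤ p * n₁ := by nlinarith
  have h_low : (p : ℤ) ≤ p * n₂ := by nlinarith
  subst hrel
  simp only [coroots, Set.mem_insert_iff, Set.mem_singleton_iff] at hα
  rcases hα with rfl | rfl | rfl | rfl | rfl | rfl <;>
  · simp only [SS, domLE, natSharp, wrot, Set.mem_ofPred_eq, Matrix.cons_val, mul_add, mul_neg,
      mul_one, mul_zero, max_le_iff, le_min_iff] at hl hl' ⊢
    generalize (p : ℤ) * n₁ = pn₁ at *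
    generalize (p : ℤ) * n₂ = pn₂ at *
    generalize (p : ℤ) * l 0 = pl₀ at *
    generalize (p : ℤ) * l 1 = pl₁ at *
    generalize (p : ℤ) * l 2 = pl₂ at *
    omega
end

section
/- Let p be a prime, let w: ℤ³ → ℤ³ be given by w(a₁, a₂, a₃) = (a₃, a₁, a₂), let τ ∈ ℤ³, and let μ = (μ₁, μ₂, μ₃) ∈ ℤ³ with μ₁ ≥ μ₂ ≥ μ₃. Define λ♮ = −λ + τ + p·w(λ) for λ ∈ ℤ³, and S = {λ ∈ ℤ³ : λ♮ ≤ μ}. Then for any λ, λ' ∈ S there exist r ≥ 0 and elements λ = λ₀, λ₁, …, λ_r = λ' of S such that λ_{i+1} − λ_i ∈ Δ∨ for every 0 ≤ i ≤ r − 1. -/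
/-- The coordinates of `λ♮`, for `λ = (x, y, z)` and `τ = (t₀, t₁, t₂)`, all lie in `[m, M]`. -/
def SharpInBox (p m M t₀ t₁ t₂ x y z : ℤ) : Prop :=
  (m ≤ -x + t₀ + p * z ∧ -x + t₀ + p * z ≤ M) ∧
  (m ≤ -y + t₁ + p * x ∧ -y + t₁ + p * x ≤ M) ∧
  (m ≤ -z + t₂ + p * y ∧ -z + t₂ + p * y ≤ M)

namespace SharpInBox

variable {p m M t₀ t₁ t₂ x y z x' y' z' : ℤ}

theorem rotate (h : SharpInBox p m M t₀ t₁ t₂ x y z) : SharpInBox p m M t₁ t₂ t₀ y z x :=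
  ⟨h.2.1, h.2.2, h.1⟩

theorem neg (h : SharpInBox p m M t₀ t₁ t₂ x y z) :
    SharpInBox p (-M) (-m) (-t₀) (-t₁) (-t₂) (-x) (-y) (-z) := by
  obtain ⟨⟨h1, h2⟩, ⟨h3, h4⟩, h5, h6⟩ := h
  refine ⟨⟨?_, ?_⟩, ⟨?_, ?_⟩, ?_, ?_⟩ <;> linarith

/-- If the target is reached by moving up in the first two coordinates, then one of the two
coroots spanning this direction gives a step that stays in the box. -/
theorem step_up (hp : 0 ≤ p) (h : SharpInBox p m M t₀ t₁ t₂ x y z)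
    (h' : SharpInBox p m M t₀ t₁ t₂ x' y' z') (hsum : x + y + z = x' + y' + z')
    (hx : x ≤ x') (hy : y ≤ y') (hz : z' < z) :
    (x < x' ∧ SharpInBox p m M t₀ t₁ t₂ (x + 1) y (z - 1)) ∨
    (y < y' ∧ SharpInBox p m M t₀ t₁ t₂ x (y + 1) (z - 1)) := by
  obtain ⟨⟨h1, h2⟩, ⟨h3, h4⟩, h5, h6⟩ := h
  obtain ⟨⟨k1, k2⟩, ⟨k3, k4⟩, k5, k6⟩ := h'
  have hpz : p * (z' + 1) ≤ p * z := mul_le_mul_of_nonneg_left hz hp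
  have hpx : p * x ≤ p * x' := mul_le_mul_of_nonneg_left hx hp
  have hpy : p * y ≤ p * y' := mul_le_mul_of_nonneg_left hy hp
  have hpx1 : x < x' → p * (x + 1) ≤ p * x' := fun h => mul_le_mul_of_nonneg_left h hp
  have hpy1 : y < y' → p * (y + 1) ≤ p * y' := fun h => mul_le_mul_of_nonneg_left h hp
  unfold SharpInBox
  rcases hx.eq_or_lt with rfl | hx
  · right
    have := hpy1 (by omega)
    refine ⟨by omega, ⟨?_, ?_⟩, ⟨?_, ?_⟩, ?_, ?_⟩ <;> linarith
  have := hpx1 hx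
  rcases hy.eq_or_lt with rfl | hy
  · left
    refine ⟨hx, ⟨?_, ?_⟩, ⟨?_, ?_⟩, ?_, ?_⟩ <;> linarith
  have := hpy1 hy
  by_cases hM : -y + t₁ + p * x - 1 < m
  · left
    refine ⟨hx, ⟨?_, ?_⟩, ⟨?_, ?_⟩, ?_, ?_⟩ <;> linarith
  · right
    refine ⟨hy, ⟨?_, ?_⟩, ⟨?_, ?_⟩, ?_, ?_⟩ <;> linarith

theorem step_down (hp : 0 ≤ p) (h : SharpInBox p m M t₀ t₁ t₂ x y z)
    (h' : SharpInBox p m M t₀ t₁ t₂ x' y' z') (hsum : x + y + z = x' + y' + z')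
    (hx : x' ≤ x) (hy : y' ≤ y) (hz : z < z') :
    (x' < x ∧ SharpInBox p m M t₀ t₁ t₂ (x - 1) y (z + 1)) ∨
    (y' < y ∧ SharpInBox p m M t₀ t₁ t₂ x (y - 1) (z + 1)) := by
  rcases step_up hp h.neg h'.neg (by linarith) (neg_le_neg hx) (neg_le_neg hy) (neg_lt_neg hz)
    with ⟨hlt, hs⟩ | ⟨hlt, hs⟩
  · exact Or.inl ⟨neg_lt_neg_iff.mp hlt, by convert hs.neg using 1 <;> ring⟩
  · exact Or.inr ⟨neg_lt_neg_iff.mp hlt, by convert hs.neg using 1 <;> ring⟩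

end SharpInBox

theorem mem_SS_iff (p : ℤ) (τ μ l : Fin 3 → ℤ) :
    l ∈ SS p τ μ ↔
      (p - 1) * (l 0 + l 1 + l 2) + (τ 0 + τ 1 + τ 2) = μ 0 + μ 1 + μ 2 ∧
        SharpInBox p (μ 2) (μ 0) (τ 0) (τ 1) (τ 2) (l 0) (l 1) (l 2) := by
  have hsum : natSharp p τ l 0 + natSharp p τ l 1 + natSharp p τ l 2 =
      (p - 1) * (l 0 + l 1 + l 2) + (τ 0 + τ 1 + τ 2) := by
    simp [natSharp, wrot]; ring
  simp only [SS, domLE, Set.mem_ofPred_eq, hsum]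
  simp [natSharp, wrot, SharpInBox]
  tauto

/-- The `ℓ¹` distance on `ℤ³`. -/
def dist₁ (l l' : Fin 3 → ℤ) : ℕ :=
  (l' 0 - l 0).natAbs + (l' 1 - l 1).natAbs + (l' 2 - l 2).natAbs

theorem exists_coroot_step {p : ℤ} (hp : 1 < p) {τ μ l l' : Fin 3 → ℤ}
    (hl : l ∈ SS p τ μ) (hl' : l' ∈ SS p τ μ) (hne : l ≠ l') :
    ∃ k ∈ SS p τ μ, (fun j => k j - l j) ∈ coroots ∧ dist₁ k l' < dist₁ l l' := by
  obtain ⟨hs, h⟩ := (mem_SS_iff p τ μ l).mp hl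
  obtain ⟨hs', h'⟩ := (mem_SS_iff p τ μ l').mp hl'
  have hsum : l 0 + l 1 + l 2 = l' 0 + l' 1 + l' 2 :=
    mul_left_cancel₀ (sub_ne_zero.mpr hp.ne') (by linarith)
  have hne' : ¬ (l 0 = l' 0 ∧ l 1 = l' 1 ∧ l 2 = l' 2) := fun ⟨h0, h1, h2⟩ =>
    hne (by ext i; fin_cases i <;> assumption)
  suffices H : ∃ a b c : ℤ, ![a, b, c] ∈ coroots ∧ a + b + c = 0 ∧
      SharpInBox p (μ 2) (μ 0) (τ 0) (τ 1) (τ 2) (l 0 + a) (l 1 + b) (l 2 + c) ∧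
      (l' 0 - (l 0 + a)).natAbs + (l' 1 - (l 1 + b)).natAbs + (l' 2 - (l 2 + c)).natAbs <
        dist₁ l l' by
    obtain ⟨a, b, c, hmem, habc, hbox, hlt⟩ := H
    refine ⟨![l 0 + a, l 1 + b, l 2 + c], (mem_SS_iff ..).mpr ⟨?_, hbox⟩, ?_, hlt⟩
    · have : l 0 + a + (l 1 + b) + (l 2 + c) = l 0 + l 1 + l 2 := by linarith
      simpa [this] using hs
    · convert hmem using 1
      ext i; fin_cases i <;> simp
  unfold dist₁
  have hp0 : 0 ≤ p := by omega
  have hsum₁ : l 1 + l 2 + l 0 = l' 1 + l' 2 + l' 0 := by linarith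
  have hsum₂ : l 2 + l 0 + l 1 = l' 2 + l' 0 + l' 1 := by linarith
  have hcases :
      (l 0 ≤ l' 0 ∧ l 1 ≤ l' 1 ∧ l' 2 < l 2) ∨ (l' 0 ≤ l 0 ∧ l' 1 ≤ l 1 ∧ l 2 < l' 2) ∨
      (l 1 ≤ l' 1 ∧ l 2 ≤ l' 2 ∧ l' 0 < l 0) ∨ (l' 1 ≤ l 1 ∧ l' 2 ≤ l 2 ∧ l 0 < l' 0) ∨
      (l 2 ≤ l' 2 ∧ l 0 ≤ l' 0 ∧ l' 1 < l 1) ∨ (l' 2 ≤ l 2 ∧ l' 0 ≤ l 0 ∧ l 1 < l' 1) := by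
    omega
  rcases hcases with ⟨ha, hb, hc⟩ | ⟨ha, hb, hc⟩ | ⟨ha, hb, hc⟩ | ⟨ha, hb, hc⟩ |
    ⟨ha, hb, hc⟩ | ⟨ha, hb, hc⟩
  · rcases h.step_up hp0 h' hsum ha hb hc with ⟨hlt, hk⟩ | ⟨hlt, hk⟩
    · exact ⟨1, 0, -1, by simp [coroots], by simp, by simpa [sub_eq_add_neg] using hk, by omega⟩
    · exact ⟨0, 1, -1, by simp [coroots], by simp, by simpa [sub_eq_add_neg] using hk, by omega⟩
  · rcases h.step_down hp0 h' hsum ha hb hc with ⟨hlt, hk⟩ | ⟨hlt, hk⟩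
    · exact ⟨-1, 0, 1, by simp [coroots], by simp, by simpa [sub_eq_add_neg] using hk, by omega⟩
    · exact ⟨0, -1, 1, by simp [coroots], by simp, by simpa [sub_eq_add_neg] using hk, by omega⟩
  · rcases h.rotate.step_up hp0 h'.rotate hsum₁ ha hb hc with ⟨hlt, hk⟩ | ⟨hlt, hk⟩
    · exact ⟨-1, 1, 0, by simp [coroots], by simp,
        by simpa [sub_eq_add_neg] using hk.rotate.rotate, by omega⟩
    · exact ⟨-1, 0, 1, by simp [coroots], by simp,
        by simpa [sub_eq_add_neg] using hk.rotate.rotate, by omega⟩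
  · rcases h.rotate.step_down hp0 h'.rotate hsum₁ ha hb hc with ⟨hlt, hk⟩ | ⟨hlt, hk⟩
    · exact ⟨1, -1, 0, by simp [coroots], by simp,
        by simpa [sub_eq_add_neg] using hk.rotate.rotate, by omega⟩
    · exact ⟨1, 0, -1, by simp [coroots], by simp,
        by simpa [sub_eq_add_neg] using hk.rotate.rotate, by omega⟩
  · rcases h.rotate.rotate.step_up hp0 h'.rotate.rotate hsum₂ ha hb hc with ⟨hlt, hk⟩ | ⟨hlt, hk⟩
    · exact ⟨0, -1, 1, by simp [coroots], by simp,
        by simpa [sub_eq_add_neg] using hk.rotate, by omega⟩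
    · exact ⟨1, -1, 0, by simp [coroots], by simp,
        by simpa [sub_eq_add_neg] using hk.rotate, by omega⟩
  · rcases h.rotate.rotate.step_down hp0 h'.rotate.rotate hsum₂ ha hb hc with
      ⟨hlt, hk⟩ | ⟨hlt, hk⟩
    · exact ⟨0, 1, -1, by simp [coroots], by simp,
        by simpa [sub_eq_add_neg] using hk.rotate, by omega⟩
    · exact ⟨-1, 1, 0, by simp [coroots], by simp,
        by simpa [sub_eq_add_neg] using hk.rotate, by omega⟩

theorem stmt_14 (p : ℕ) (hp : p.Prime) (τ μ : Fin 3 → ℤ)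
    (hμ : μ 1 ≤ μ 0 ∧ μ 2 ≤ μ 1)
    (l l' : Fin 3 → ℤ) (hl : l ∈ SS p τ μ) (hl' : l' ∈ SS p τ μ) :
    ∃ (r : ℕ) (c : ℕ → Fin 3 → ℤ), c 0 = l ∧ c r = l' ∧
      (∀ i ≤ r, c i ∈ SS p τ μ) ∧
      (∀ i < r, (fun j => c (i + 1) j - c i j) ∈ coroots) := by
  induction hd : dist₁ l l' using Nat.strong_induction_on generalizing l with
  | _ d ih =>
    by_cases hne : l = l'
    · exact ⟨0, fun _ => l, rfl, hne, fun _ _ => hl, fun i hi => absurd hi i.not_lt_zero⟩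
    obtain ⟨k, hk, hcoroot, hlt⟩ :=
      exists_coroot_step (by exact_mod_cast hp.one_lt) hl hl' hne
    obtain ⟨r, c, hc0, hcr, hmem, hstep⟩ := ih _ (hd ▸ hlt) k hk rfl
    refine ⟨r + 1, fun n => Nat.casesOn n l c, rfl, hcr, ?_, ?_⟩
    · rintro (_ | i) hi
      · exact hl
      · exact hmem i (Nat.le_of_succ_le_succ hi)
    · rintro (_ | i) hi
      · simpa [hc0] using hcoroot
      · exact hstep i (Nat.lt_of_succ_lt_succ hi)
end

section
/- Let w: ℤ³ → ℤ³ be given by w(a₁, a₂, a₃) = (a₃, a₁, a₂). For every v ∈ ℤ³ with v₁ + v₂ + v₃ = 0 there exist a coroot α ∈ Δ∨ and integers n₁ ≥ n₂ ≥ 0 such that v = n₁·α + n₂·w(α). -/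
theorem stmt_16 (v : Fin 3 → ℤ) (hv : v 0 + v 1 + v 2 = 0) :
    ∃ α ∈ coroots, ∃ n₁ n₂ : ℤ, n₂ ≤ n₁ ∧ 0 ≤ n₂ ∧
      v = fun i => n₁ * α i + n₂ * wrot α i := by
  have signs : (v 1 ≤ 0 ∧ v 2 ≤ 0) ∨ (0 ≤ v 1 ∧ 0 ≤ v 2) ∨ (v 2 ≤ 0 ∧ v 0 ≤ 0) ∨
      (0 ≤ v 2 ∧ 0 ≤ v 0) ∨ (v 0 ≤ 0 ∧ v 1 ≤ 0) ∨ (0 ≤ v 0 ∧ 0 ≤ v 1) := by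
    omega
  rcases signs with h | h | h | h | h | h
  · refine ⟨![1, -1, 0], by simp [coroots], v 0, -v 2, by omega, by omega, ?_⟩
    ext i
    fin_cases i <;> simp [wrot] <;> omega
  · refine ⟨![-1, 1, 0], by simp [coroots], -v 0, v 2, by omega, by omega, ?_⟩
    ext i
    fin_cases i <;> simp [wrot] <;> omega
  · refine ⟨![0, 1, -1], by simp [coroots], v 1, -v 0, by omega, by omega, ?_⟩
    ext i
    fin_cases i <;> simp [wrot] <;> omega
  · refine ⟨![0, -1, 1], by simp [coroots], -v 1, v 0, by omega, by omega, ?_⟩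
    ext i
    fin_cases i <;> simp [wrot] <;> omega
  · refine ⟨![-1, 0, 1], by simp [coroots], v 2, -v 1, by omega, by omega, ?_⟩
    ext i
    fin_cases i <;> simp [wrot] <;> omega
  · refine ⟨![1, 0, -1], by simp [coroots], -v 2, v 1, by omega, by omega, ?_⟩
    ext i
    fin_cases i <;> simp [wrot] <;> omega
end
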